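/- Let ν be real with ν > −1 and let f₁, f₂ ∈ S_ν([0,∞)). Then ⟨f₁, H_ν(f₂)⟩ = ⟨H_ν(f₁), f₂⟩, i.e. ∫₀^∞ f₁(x)·conj(H_ν(f₂)(x)) dx/x = ∫₀^∞ H_ν(f₁)(x)·conj(f₂(x)) dx/x, both integrals converging absolutely. -/

import Mathlib

open MeasureTheory Set

/-- The classical J-Bessel function of complex index `ν`, via its power series
(principal branch of powers). -/
noncomputable def besselJ (ν : ℂ) (x : ℝ) : ℂ :=
  ∑' k : ℕ, ((-1 : ℂ) ^ k * ((x / 2 : ℝ) : ℂ) ^ (ν + 2 * (k : ℂ))) /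
    (Complex.Gamma ((k : ℂ) + 1) * Complex.Gamma ((k : ℂ) + ν + 1))

/-- `g` and all of its derivatives are rapidly decreasing at `+∞`. -/
def RapidlyDecreasing (g : ℝ → ℂ) : Prop :=
  ∀ m n : ℕ, ∃ C : ℝ, ∀ x : ℝ, 1 ≤ x → x ^ m * ‖iteratedDeriv n g x‖ ≤ C

/-- Membership in the Schwartz space `S([0,∞))`: `f` agrees on `[0,∞)` with a smooth
function on `ℝ` all of whose derivatives are rapidly decreasing at `+∞`. -/
def MemSHalf (f : ℝ → ℂ) : Prop :=
  ∃ g : ℝ → ℂ, ContDiff ℝ (⊤ : ℕ∞) g ∧ (∀ x : ℝ, 0 ≤ x → f x = g x) ∧ RapidlyDecreasing g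

/-- Membership in `S_ν([0,∞))`: `f(x) = x^{(ν+1)/2} f₁(x)` on `[0,∞)` for some
`f₁ ∈ S([0,∞))` (principal branch of the complex power). -/
def MemSnu (ν : ℂ) (f : ℝ → ℂ) : Prop :=
  ∃ f₁ : ℝ → ℂ, MemSHalf f₁ ∧ ∀ x : ℝ, 0 ≤ x → f x = (x : ℂ) ^ ((ν + 1) / 2) * f₁ x

/-- The Hankel transform of order `ν`: `H_ν(f)(y) = ∫₀^∞ f(x) √(xy) J_ν(2√(xy)) dx/x`. -/
noncomputable def hankel (ν : ℂ) (f : ℝ → ℂ) (y : ℝ) : ℂ :=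
  ∫ x in Ioi (0 : ℝ), f x * (Real.sqrt (x * y) : ℂ) * besselJ ν (2 * Real.sqrt (x * y)) / (x : ℂ)

/-- The coefficients `1 / (k! Γ(k + μ + 1))` of the entire function underlying `J_μ`. -/
noncomputable def besselCoeff (μ : ℝ) (k : ℕ) : ℝ :=
  ((k.factorial : ℝ) * Real.Gamma (k + μ + 1))⁻¹

/-- The entire function `t ↦ ∑ (-t)^k / (k! Γ(k + μ + 1))`, which is `t^{-μ/2} J_μ(2√t)`
for `t > 0`. -/
noncomputable def besselEntire (μ t : ℝ) : ℝ :=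
  ∑' k : ℕ, besselCoeff μ k * (-t) ^ k

lemma besselCoeff_nonneg {μ : ℝ} (hμ : -1 < μ) (k : ℕ) : 0 ≤ besselCoeff μ k := by
  have hk : (0 : ℝ) ≤ k := k.cast_nonneg
  have := Real.Gamma_pos_of_pos (show 0 < (k : ℝ) + μ + 1 by linarith)
  unfold besselCoeff
  positivity

lemma besselCoeff_succ (μ : ℝ) (k : ℕ) :
    ((k : ℝ) + 1) * besselCoeff μ (k + 1) = besselCoeff (μ + 1) k := by
  have h1 : ((k : ℝ) + 1) ≠ 0 := by positivity
  have h2 : ((k + 1 : ℕ) : ℝ) + μ + 1 = k + (μ + 1) + 1 := by push_cast; ring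
  unfold besselCoeff
  rw [h2, Nat.factorial_succ]
  push_cast
  rw [mul_assoc, mul_inv, ← mul_assoc, mul_inv_cancel₀ h1, one_mul]

lemma besselCoeff_eq {μ : ℝ} (hμ : -1 < μ) (k : ℕ) :
    besselCoeff μ k = (k + μ + 1) * besselCoeff (μ + 1) k := by
  have hk : (0 : ℝ) ≤ k := k.cast_nonneg
  have h : (k : ℝ) + μ + 1 ≠ 0 := by linarith
  have h2 : (k : ℝ) + (μ + 1) + 1 = (k + μ + 1) + 1 := by ring
  unfold besselCoeff
  rw [h2, Real.Gamma_add_one h, mul_left_comm, mul_inv (_ + _ + _), ← mul_assoc,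
    mul_inv_cancel₀ h, one_mul]

lemma exists_besselCoeff_le {μ : ℝ} (hμ : -1 < μ) :
    ∃ C : ℝ, ∀ k : ℕ, besselCoeff μ k ≤ C / k.factorial := by
  have key : ∀ k : ℕ, (Real.Gamma (k + μ + 1))⁻¹ ≤
      max (Real.Gamma (μ + 1))⁻¹ (Real.Gamma (μ + 2))⁻¹ := by
    intro k
    induction k with
    | zero => simp
    | succ k ih =>
      rcases Nat.eq_zero_or_pos k with rfl | hk
      · refine le_max_of_le_right (le_of_eq ?_)
        congr 2
        push_cast
        ring
      · have hk' : (1 : ℝ) ≤ k := by exact_mod_cast hk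
        have hs : 1 ≤ (k : ℝ) + μ + 1 := by linarith
        have hG := Real.Gamma_pos_of_pos (show 0 < (k : ℝ) + μ + 1 by linarith)
        refine le_trans ?_ ih
        have h2 : ((k + 1 : ℕ) : ℝ) + μ + 1 = (k + μ + 1) + 1 := by push_cast; ring
        rw [h2, Real.Gamma_add_one (by linarith)]
        exact inv_anti₀ hG (le_mul_of_one_le_left hG.le hs)
  refine ⟨max (Real.Gamma (μ + 1))⁻¹ (Real.Gamma (μ + 2))⁻¹, fun k => ?_⟩
  have hf : (0 : ℝ) < k.factorial := by positivity
  rw [besselCoeff, mul_inv, mul_comm, ← div_eq_mul_inv]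
  exact div_le_div_of_nonneg_right (key k) hf.le

lemma summable_besselCoeff_mul_pow {μ : ℝ} (hμ : -1 < μ) (t : ℝ) :
    Summable fun k : ℕ => besselCoeff μ k * t ^ k := by
  obtain ⟨C, hC⟩ := exists_besselCoeff_le hμ
  refine Summable.of_norm_bounded ((Real.summable_pow_div_factorial |t|).mul_left C) fun k => ?_
  rw [norm_mul, Real.norm_of_nonneg (besselCoeff_nonneg hμ k), norm_pow, Real.norm_eq_abs]
  calc _ ≤ C / k.factorial * |t| ^ k := by gcongr; exact hC k
    _ = _ := by ring

lemma besselEntire_recurrence {μ : ℝ} (hμ : -1 < μ) (t : ℝ) :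
    besselEntire μ t = (μ + 1) * besselEntire (μ + 1) t - t * besselEntire (μ + 2) t := by
  have h1 := summable_besselCoeff_mul_pow (show -1 < μ + 1 by linarith) (-t)
  have h2 := summable_besselCoeff_mul_pow (show -1 < μ + 2 by linarith) (-t)
  have hshift : ∀ k : ℕ, ((k + 1 : ℕ) : ℝ) * besselCoeff (μ + 1) (k + 1) * (-t) ^ (k + 1) =
      (-t) * (besselCoeff (μ + 2) k * (-t) ^ k) := by
    intro k
    have := besselCoeff_succ (μ + 1) k
    rw [show μ + 1 + 1 = μ + 2 by ring] at this
    push_cast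
    rw [this, pow_succ]
    ring
  have h3 : Summable fun k : ℕ => (k : ℝ) * besselCoeff (μ + 1) k * (-t) ^ k := by
    rw [← summable_nat_add_iff 1]
    exact (h2.mul_left (-t)).congr fun k => (hshift k).symm
  have h4 : ∑' k : ℕ, (k : ℝ) * besselCoeff (μ + 1) k * (-t) ^ k =
      -(t * besselEntire (μ + 2) t) := by
    rw [h3.tsum_eq_zero_add, tsum_congr hshift, tsum_mul_left, besselEntire]
    simp
  rw [sub_eq_add_neg, ← h4]
  unfold besselEntire
  rw [← tsum_mul_left, ← (h1.mul_left (μ + 1)).tsum_add h3]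
  refine tsum_congr fun k => ?_
  rw [besselCoeff_eq hμ k]
  ring

lemma hasDerivAt_besselEntire {μ : ℝ} (hμ : -1 < μ) (t : ℝ) :
    HasDerivAt (besselEntire μ) (-besselEntire (μ + 1) t) t := by
  set R : ℝ := |t| + 1
  have hshift : ∀ (x : ℝ) (k : ℕ), besselCoeff μ (k + 1) * (((k + 1 : ℕ) : ℝ) * x ^ k) =
      besselCoeff (μ + 1) k * x ^ k := by
    intro x k
    rw [← besselCoeff_succ]
    push_cast
    ring
  have hsum : ∀ x : ℝ, Summable fun k : ℕ => besselCoeff μ k * ((k : ℝ) * x ^ (k - 1)) := by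
    intro x
    rw [← summable_nat_add_iff 1]
    exact (summable_besselCoeff_mul_pow (show -1 < μ + 1 by linarith) x).congr
      fun k => (hshift x k).symm
  have hval : ∑' k : ℕ, besselCoeff μ k * ((k : ℝ) * (-t) ^ (k - 1) * (-1)) =
      -besselEntire (μ + 1) t := by
    simp_rw [← mul_assoc, mul_neg_one, tsum_neg, mul_assoc]
    rw [(hsum (-t)).tsum_eq_zero_add, besselEntire]
    simp only [Nat.add_sub_cancel, hshift]
    simp
  rw [← hval]
  refine hasDerivAt_tsum_of_isPreconnected (hsum R) Metric.isOpen_ball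
    (convex_ball (0 : ℝ) R).isPreconnected (y₀ := 0)
    (fun k y _ => (((hasDerivAt_id' y).neg.pow k).const_mul (besselCoeff μ k)))
    (fun k y hy => ?_) (by simp [R]; positivity) (summable_besselCoeff_mul_pow hμ (-0)) ?_
  · have hy' : |y| ≤ R := by simpa using (mem_ball_zero_iff.mp hy).le
    rw [norm_mul, Real.norm_of_nonneg (besselCoeff_nonneg hμ k)]
    refine mul_le_mul_of_nonneg_left ?_ (besselCoeff_nonneg hμ k)
    simp only [norm_mul, norm_pow, norm_neg, norm_one, mul_one, Real.norm_eq_abs, Nat.abs_cast]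
    gcongr
    simpa using hy'
  · simp [R]

lemma continuous_besselEntire {μ : ℝ} (hμ : -1 < μ) : Continuous (besselEntire μ) :=
  continuous_iff_continuousAt.mpr fun t => (hasDerivAt_besselEntire hμ t).continuousAt

/-- The energy of the solution `besselEntire μ` of its second order differential equation, divided
by `t`, is antitone. -/
lemma antitoneOn_besselEntire_energy {μ : ℝ} (hμ : -1 < μ) :
    AntitoneOn (fun t => (besselEntire μ t ^ 2 + t * besselEntire (μ + 1) t ^ 2) / t)
      (Ici 1) := by
  have hd : ∀ t : ℝ, 0 < t → HasDerivAt
      (fun t => (besselEntire μ t ^ 2 + t * besselEntire (μ + 1) t ^ 2) / t)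
      (-((2 * μ + 1) * t * besselEntire (μ + 1) t ^ 2 + besselEntire μ t ^ 2 +
        t * besselEntire (μ + 1) t ^ 2) / t ^ 2) t := by
    intro t ht
    have h0 := hasDerivAt_besselEntire hμ t
    have h1 := hasDerivAt_besselEntire (show -1 < μ + 1 by linarith) t
    rw [show μ + 1 + 1 = μ + 2 by ring] at h1
    have hr := besselEntire_recurrence hμ t
    refine (((h0.pow 2).add ((hasDerivAt_id' t).mul (h1.pow 2))).div (hasDerivAt_id' t)
      ht.ne').congr_deriv ?_
    have hr' : t * besselEntire (μ + 2) t =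
        (μ + 1) * besselEntire (μ + 1) t - besselEntire μ t := by linarith
    congr 1
    simp only [Pi.add_apply, Pi.mul_apply, Pi.pow_apply]
    push_cast
    linear_combination (-2 * t * besselEntire (μ + 1) t) * hr'
  refine antitoneOn_of_deriv_nonpos (convex_Ici 1)
    (fun t ht => (hd t (lt_of_lt_of_le one_pos ht)).continuousAt.continuousWithinAt)
    (fun t ht => ?_) (fun t ht => ?_)
  · rw [interior_Ici] at ht
    exact (hd t (one_pos.trans ht)).differentiableAt.differentiableWithinAt
  · rw [interior_Ici] at ht
    have ht' : 0 < t := one_pos.trans ht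
    rw [(hd t ht').deriv]
    refine div_nonpos_of_nonpos_of_nonneg ?_ (sq_nonneg t)
    nlinarith [mul_nonneg (mul_nonneg (show 0 ≤ 2 * μ + 2 by linarith) ht'.le)
      (sq_nonneg (besselEntire (μ + 1) t)), sq_nonneg (besselEntire μ t)]

lemma exists_abs_besselEntire_le {μ : ℝ} (hμ : -1 < μ) :
    ∃ C : ℝ, 0 ≤ C ∧ ∀ t : ℝ, 0 ≤ t → |besselEntire μ t| ≤ C * (1 + t) := by
  obtain ⟨M, hM⟩ := (isCompact_Icc (a := (0 : ℝ)) (b := 1)).exists_bound_of_continuousOn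
    (continuous_besselEntire hμ).continuousOn
  set E : ℝ := besselEntire μ 1 ^ 2 + besselEntire (μ + 1) 1 ^ 2
  have hE : 0 ≤ E := by positivity
  have hM0 : 0 ≤ M := (norm_nonneg _).trans (hM 0 (by simp))
  refine ⟨M + (1 + E), by positivity, fun t ht => ?_⟩
  rcases le_total t 1 with h | h
  · have := hM t ⟨ht, h⟩
    rw [Real.norm_eq_abs] at this
    nlinarith [mul_nonneg hM0 ht, mul_nonneg hE ht]
  · have ht' : 0 < t := one_pos.trans_le h
    have := antitoneOn_besselEntire_energy hμ (mem_Ici.mpr le_rfl) (mem_Ici.mpr h) h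
    simp only [one_mul, div_one] at this
    rw [div_le_iff₀ ht'] at this
    have h2 : |besselEntire μ t| ^ 2 ≤ E * t := by
      rw [sq_abs]
      nlinarith [mul_nonneg ht (sq_nonneg (besselEntire (μ + 1) t))]
    refine abs_le_of_sq_le_sq' ?_ (by positivity) |>.2
    refine h2.trans ?_
    nlinarith [mul_nonneg hM0 ht, mul_nonneg hE ht, mul_nonneg hE hE,
      mul_nonneg (mul_nonneg hE hE) ht, sq_nonneg ((M + E) * (1 + t)),
      mul_nonneg (add_nonneg hM0 hE) ht]

lemma besselJ_two_mul_sqrt {ν t : ℝ} (ht : 0 < t) :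
    besselJ (ν : ℂ) (2 * Real.sqrt t) = ((t ^ (ν / 2) * besselEntire ν t : ℝ) : ℂ) := by
  rw [besselEntire, ← tsum_mul_left, Complex.ofReal_tsum, besselJ]
  refine tsum_congr fun k => ?_
  have hpow : ((2 * Real.sqrt t / 2 : ℝ) : ℂ) ^ ((ν : ℂ) + 2 * (k : ℂ)) =
      ((t ^ (ν / 2) * t ^ k : ℝ) : ℂ) := by
    rw [mul_div_cancel_left₀ _ (two_ne_zero' ℝ),
      show (ν : ℂ) + 2 * (k : ℂ) = ((ν + 2 * k : ℝ) : ℂ) by push_cast; rfl,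
      ← Complex.ofReal_cpow (Real.sqrt_nonneg t), Real.sqrt_eq_rpow, ← Real.rpow_mul ht.le,
      ← Real.rpow_natCast t k, ← Real.rpow_add ht]
    congr 2
    ring
  have hG : Complex.Gamma ((k : ℂ) + ν + 1) = ((Real.Gamma (k + ν + 1) : ℝ) : ℂ) := by
    rw [← Complex.Gamma_ofReal]
    push_cast
    rfl
  rw [hpow, hG, Complex.Gamma_nat_eq_factorial, besselCoeff, neg_pow t k]
  push_cast
  ring

lemma hankel_kernel_eq {ν x y : ℝ} (hx : 0 < x) (hy : 0 < y) (c : ℂ) :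
    (x : ℂ) ^ (((ν : ℂ) + 1) / 2) * c * (Real.sqrt (x * y) : ℂ) *
        besselJ (ν : ℂ) (2 * Real.sqrt (x * y)) / (x : ℂ) =
      ((y ^ ((ν + 1) / 2) : ℝ) : ℂ) * (((x ^ ν * besselEntire ν (x * y) : ℝ) : ℂ) * c) := by
  have hxp : (x : ℂ) ^ (((ν : ℂ) + 1) / 2) = ((x ^ ((ν + 1) / 2) : ℝ) : ℂ) := by
    rw [Complex.ofReal_cpow hx.le]
    push_cast
    rfl
  have hreal : x ^ ((ν + 1) / 2) * Real.sqrt (x * y) * (x * y) ^ (ν / 2) / x =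
      y ^ ((ν + 1) / 2) * x ^ ν := by
    rw [mul_assoc, Real.sqrt_eq_rpow, ← Real.rpow_add (mul_pos hx hy),
      show 1 / 2 + ν / 2 = (ν + 1) / 2 by ring, Real.mul_rpow hx.le hy.le, ← mul_assoc,
      ← Real.rpow_add hx, add_halves, Real.rpow_add_one hx.ne']
    field_simp
  rw [hxp, besselJ_two_mul_sqrt (mul_pos hx hy)]
  calc _ = ((x ^ ((ν + 1) / 2) * Real.sqrt (x * y) * (x * y) ^ (ν / 2) / x : ℝ) : ℂ) *
        (besselEntire ν (x * y) : ℂ) * c := by push_cast; ring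
    _ = _ := by rw [hreal]; push_cast; ring

lemma MemSnu.exists_continuous {ν : ℂ} {f : ℝ → ℂ} (hf : MemSnu ν f) :
    ∃ g : ℝ → ℂ, Continuous g ∧ (∀ m : ℕ, ∃ C : ℝ, ∀ x : ℝ, 1 ≤ x → x ^ m * ‖g x‖ ≤ C) ∧
      ∀ x : ℝ, 0 ≤ x → f x = (x : ℂ) ^ ((ν + 1) / 2) * g x := by
  obtain ⟨h, ⟨g, hg, hhg, hdec⟩, hfh⟩ := hf
  exact ⟨g, hg.continuous, fun m => by simpa using hdec m 0,
    fun x hx => by rw [hfh x hx, hhg x hx]⟩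

lemma integrableOn_rpow_mul_of_rapidDecay {ν : ℝ} (hν : -1 < ν) {g : ℝ → ℂ}
    (hg : Continuous g) (hdec : ∀ m : ℕ, ∃ C : ℝ, ∀ x : ℝ, 1 ≤ x → x ^ m * ‖g x‖ ≤ C) :
    IntegrableOn (fun x : ℝ => x ^ ν * ((1 + x) * ‖g x‖)) (Ioi 0) := by
  have hmeas : Measurable fun x : ℝ => x ^ ν * ((1 + x) * ‖g x‖) :=
    (measurable_id.pow_const ν).mul
      ((measurable_const.add measurable_id).mul hg.norm.measurable)
  rw [← Ioc_union_Ioi_eq_Ioi (zero_le_one' ℝ)]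
  refine IntegrableOn.union ?_ ?_
  · have h := (intervalIntegrable_iff_integrableOn_Ioc_of_le (zero_le_one' ℝ)).mp
      (intervalIntegral.intervalIntegrable_rpow' (a := 0) (b := 1) hν)
    obtain ⟨M, hM⟩ := (isCompact_Icc (a := (0 : ℝ)) (b := 1)).exists_bound_of_continuousOn
      hg.continuousOn
    refine (h.mul_const (2 * M)).mono' hmeas.aestronglyMeasurable ?_
    refine (ae_restrict_iff' measurableSet_Ioc).mpr (.of_forall fun x hx => ?_)
    have hgx := hM x ⟨hx.1.le, hx.2⟩
    have h1 : 0 ≤ 1 + x := by linarith [hx.1]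
    have h2 : 1 + x ≤ 2 := by linarith [hx.2]
    have h3 := Real.rpow_nonneg hx.1.le ν
    rw [Real.norm_of_nonneg (by positivity)]
    gcongr
  · obtain ⟨m, hm⟩ := exists_nat_gt (ν + 2)
    obtain ⟨C, hC⟩ := hdec m
    have h := integrableOn_Ioi_rpow_of_lt (show ν + 1 - m < -1 by linarith) one_pos
    refine (h.mul_const (2 * C)).mono' hmeas.aestronglyMeasurable ?_
    refine (ae_restrict_iff' measurableSet_Ioi).mpr (.of_forall fun x hx => ?_)
    have hx1 : 1 ≤ x := (mem_Ioi.mp hx).le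
    have hx0 : 0 < x := one_pos.trans_le hx1
    have h3 := Real.rpow_pos_of_pos hx0 ν
    have hxm : 0 < x ^ m := pow_pos hx0 m
    rw [Real.norm_of_nonneg (by positivity), Real.rpow_sub hx0, Real.rpow_add_one hx0.ne',
      Real.rpow_natCast]
    have hgx : ‖g x‖ ≤ C / x ^ m := by
      rw [le_div_iff₀ hxm, mul_comm]
      exact hC x hx1
    calc x ^ ν * ((1 + x) * ‖g x‖) ≤ x ^ ν * ((2 * x) * (C / x ^ m)) := by
          gcongr
          linarith
      _ = _ := by ring

lemma integrable_hankel_kernel {ν : ℝ} (hν : -1 < ν) {g h : ℝ → ℂ} (hg : Continuous g)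
    (hh : Continuous h) (hgi : IntegrableOn (fun x : ℝ => x ^ ν * ((1 + x) * ‖g x‖)) (Ioi 0))
    (hhi : IntegrableOn (fun x : ℝ => x ^ ν * ((1 + x) * ‖h x‖)) (Ioi 0)) :
    Integrable (fun p : ℝ × ℝ => ((p.1 ^ ν * p.2 ^ ν * besselEntire ν (p.1 * p.2) : ℝ) : ℂ) *
        (g p.1 * (starRingEnd ℂ) (h p.2)))
      ((volume.restrict (Ioi 0)).prod (volume.restrict (Ioi 0))) := by
  obtain ⟨C, hC, hbound⟩ := exists_abs_besselEntire_le hν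
  refine ((hgi.mul_prod hhi).const_mul C).mono' ?_ ?_
  · have h1 : Measurable fun p : ℝ × ℝ => p.1 ^ ν * p.2 ^ ν * besselEntire ν (p.1 * p.2) :=
      ((measurable_fst.pow_const ν).mul (measurable_snd.pow_const ν)).mul
        ((continuous_besselEntire hν).comp (continuous_fst.mul continuous_snd)).measurable
    have h2 : Continuous fun p : ℝ × ℝ => g p.1 * (starRingEnd ℂ) (h p.2) :=
      (hg.comp continuous_fst).mul (Complex.continuous_conj.comp (hh.comp continuous_snd))
    exact ((Complex.measurable_ofReal.comp h1).mul h2.measurable).aestronglyMeasurable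
  · rw [Measure.prod_restrict]
    refine (ae_restrict_iff' (measurableSet_Ioi.prod measurableSet_Ioi)).mpr
      (.of_forall fun p hp => ?_)
    have hx : 0 < p.1 := hp.1
    have hy : 0 < p.2 := hp.2
    have hx' := Real.rpow_pos_of_pos hx ν
    have hy' := Real.rpow_pos_of_pos hy ν
    have hb := hbound (p.1 * p.2) (by positivity)
    have hb' : |besselEntire ν (p.1 * p.2)| ≤ C * ((1 + p.1) * (1 + p.2)) :=
      hb.trans (mul_le_mul_of_nonneg_left (by nlinarith) hC)
    rw [norm_mul, norm_mul, RCLike.norm_conj, Complex.norm_real, Real.norm_eq_abs, abs_mul,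
      abs_of_pos (mul_pos hx' hy')]
    calc _ ≤ p.1 ^ ν * p.2 ^ ν * (C * ((1 + p.1) * (1 + p.2))) * (‖g p.1‖ * ‖h p.2‖) := by gcongr
      _ = _ := by ring

lemma hankel_eq_of_eq_cpow_mul {ν : ℝ} {f g : ℝ → ℂ}
    (hfg : ∀ x : ℝ, 0 ≤ x → f x = (x : ℂ) ^ (((ν : ℂ) + 1) / 2) * g x) {y : ℝ} (hy : 0 < y) :
    hankel (ν : ℂ) f y = ((y ^ ((ν + 1) / 2) : ℝ) : ℂ) *
      ∫ x in Ioi (0 : ℝ), ((x ^ ν * besselEntire ν (x * y) : ℝ) : ℂ) * g x := by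
  rw [hankel, ← integral_const_mul]
  refine setIntegral_congr_fun measurableSet_Ioi fun x hx => ?_
  simp only [hfg x (mem_Ioi.mp hx).le]
  exact hankel_kernel_eq hx hy _

/-- The weights `x^{(ν+1)/2}` of a function in `S_ν` and of a Hankel transform combine to
`x^ν dx`. -/
lemma rpow_half_mul_rpow_half_div {ν x : ℝ} (hx : 0 < x) :
    (x : ℂ) ^ (((ν : ℂ) + 1) / 2) * ((x ^ ((ν + 1) / 2) : ℝ) : ℂ) / (x : ℂ) =
      ((x ^ ν : ℝ) : ℂ) := by
  have hxp : (x : ℂ) ^ (((ν : ℂ) + 1) / 2) = ((x ^ ((ν + 1) / 2) : ℝ) : ℂ) := by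
    rw [Complex.ofReal_cpow hx.le]
    push_cast
    rfl
  rw [hxp, ← Complex.ofReal_mul, ← Complex.ofReal_div, ← Real.rpow_add hx, add_halves,
    Real.rpow_add_one hx.ne', mul_div_cancel_right₀ _ hx.ne']

lemma mul_conj_hankel_div_eq {ν : ℝ} {f₁ f₂ g₁ g₂ : ℝ → ℂ}
    (h₁ : ∀ x : ℝ, 0 ≤ x → f₁ x = (x : ℂ) ^ (((ν : ℂ) + 1) / 2) * g₁ x)
    (h₂ : ∀ x : ℝ, 0 ≤ x → f₂ x = (x : ℂ) ^ (((ν : ℂ) + 1) / 2) * g₂ x) {x : ℝ} (hx : 0 < x) :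
    f₁ x * (starRingEnd ℂ) (hankel (ν : ℂ) f₂ x) / (x : ℂ) =
      ∫ y in Ioi (0 : ℝ), ((x ^ ν * y ^ ν * besselEntire ν (x * y) : ℝ) : ℂ) *
        (g₁ x * (starRingEnd ℂ) (g₂ y)) := by
  rw [hankel_eq_of_eq_cpow_mul h₂ hx, map_mul, Complex.conj_ofReal, ← integral_conj, h₁ x hx.le]
  calc _ = ((x : ℂ) ^ (((ν : ℂ) + 1) / 2) * ((x ^ ((ν + 1) / 2) : ℝ) : ℂ) / (x : ℂ)) * g₁ x *
        ∫ y in Ioi (0 : ℝ), (starRingEnd ℂ)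
          (((y ^ ν * besselEntire ν (y * x) : ℝ) : ℂ) * g₂ y) := by ring
    _ = _ := by
      rw [rpow_half_mul_rpow_half_div hx, ← integral_const_mul]
      congr 1 with y
      rw [map_mul, Complex.conj_ofReal, mul_comm y x]
      push_cast
      ring

lemma hankel_mul_conj_div_eq {ν : ℝ} {f₁ f₂ g₁ g₂ : ℝ → ℂ}
    (h₁ : ∀ x : ℝ, 0 ≤ x → f₁ x = (x : ℂ) ^ (((ν : ℂ) + 1) / 2) * g₁ x)
    (h₂ : ∀ x : ℝ, 0 ≤ x → f₂ x = (x : ℂ) ^ (((ν : ℂ) + 1) / 2) * g₂ x) {y : ℝ} (hy : 0 < y) :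
    hankel (ν : ℂ) f₁ y * (starRingEnd ℂ) (f₂ y) / (y : ℂ) =
      ∫ x in Ioi (0 : ℝ), ((x ^ ν * y ^ ν * besselEntire ν (x * y) : ℝ) : ℂ) *
        (g₁ x * (starRingEnd ℂ) (g₂ y)) := by
  have h := congrArg (starRingEnd ℂ) (mul_conj_hankel_div_eq h₂ h₁ hy)
  rw [← integral_conj] at h
  simp only [map_div₀, map_mul, Complex.conj_conj, Complex.conj_ofReal] at h
  rw [mul_comm (hankel _ _ _), h]
  congr 1 with x
  rw [mul_comm y x, mul_comm (y ^ ν) (x ^ ν), mul_comm (g₁ x)]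

/-- for real `ν > -1` and `f₁, f₂ ∈ S_ν([0,∞))`,
`⟨f₁, H_ν(f₂)⟩ = ⟨H_ν(f₁), f₂⟩` with both integrals converging absolutely. -/
theorem hankel_symmetric (ν : ℝ) (hν : -1 < ν) (f₁ f₂ : ℝ → ℂ)
    (hf₁ : MemSnu (ν : ℂ) f₁) (hf₂ : MemSnu (ν : ℂ) f₂) :
    IntegrableOn (fun x : ℝ => f₁ x * (starRingEnd ℂ) (hankel (ν : ℂ) f₂ x) / (x : ℂ)) (Ioi 0) ∧
    IntegrableOn (fun x : ℝ => hankel (ν : ℂ) f₁ x * (starRingEnd ℂ) (f₂ x) / (x : ℂ)) (Ioi 0) ∧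
    (∫ x in Ioi (0 : ℝ), f₁ x * (starRingEnd ℂ) (hankel (ν : ℂ) f₂ x) / (x : ℂ)) =
      ∫ x in Ioi (0 : ℝ), hankel (ν : ℂ) f₁ x * (starRingEnd ℂ) (f₂ x) / (x : ℂ) := by
  obtain ⟨g₁, hg₁, hdec₁, h₁⟩ := hf₁.exists_continuous
  obtain ⟨g₂, hg₂, hdec₂, h₂⟩ := hf₂.exists_continuous
  have hK := integrable_hankel_kernel hν hg₁ hg₂
    (integrableOn_rpow_mul_of_rapidDecay hν hg₁ hdec₁)
    (integrableOn_rpow_mul_of_rapidDecay hν hg₂ hdec₂)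
  refine ⟨?_, ?_, ?_⟩
  · exact IntegrableOn.congr_fun (s := Ioi 0) hK.integral_prod_left
      (fun x hx => (mul_conj_hankel_div_eq h₁ h₂ hx).symm) measurableSet_Ioi
  · exact IntegrableOn.congr_fun (s := Ioi 0) hK.integral_prod_right
      (fun x hx => (hankel_mul_conj_div_eq h₁ h₂ hx).symm) measurableSet_Ioi
  · rw [setIntegral_congr_fun measurableSet_Ioi fun x hx => mul_conj_hankel_div_eq h₁ h₂ hx,
      setIntegral_congr_fun measurableSet_Ioi fun x hx => hankel_mul_conj_div_eq h₁ h₂ hx]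
    exact integral_integral_swap hK
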